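/- If m ≥ 2, then there exists an index k with 1 ≤ k ≤ m such that the union ⋃_{t ≠ k} T_t is connected. -/

import Mathlib

/-
Setting (Section 2.3 of the paper, topological abstraction):
`X` is a nonempty connected Noetherian topological space with irreducible
components `C 0, …, C (n-1)`.  `Z ⊆ X` is a closed subset containing all
pairwise intersections of irreducible components and containing no irreducible
component.  `W 0, …, W (m-1)` are the connected components of `Z`, and
`T j := (⋃_{i : C i ∩ W j ≠ ∅} C i) \ (⋃_{t ≠ j} W t)`.
-/
open Set

theorem IsPreirreducible.inter_isOpen {X : Type*} [TopologicalSpace X] {s U : Set X}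
    (hs : IsPreirreducible s) (hU : IsOpen U) : IsPreirreducible (s ∩ U) := by
  rintro u v hu hv ⟨x, ⟨hxs, hxU⟩, hxu⟩ ⟨y, ⟨hys, hyU⟩, hyv⟩
  obtain ⟨z, hzs, ⟨hzU, hzu⟩, -, hzv⟩ :=
    hs (U ∩ u) (U ∩ v) (hU.inter hu) (hU.inter hv) ⟨x, hxs, hxU, hxu⟩ ⟨y, hys, hyU, hyv⟩
  exact ⟨z, ⟨hzs, hzU⟩, hzu, hzv⟩

theorem IsClosed.isClosed_connectedComponentIn {X : Type*} [TopologicalSpace X] {F : Set X}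
    (hF : IsClosed F) {x : X} (hx : x ∈ F) : IsClosed (connectedComponentIn F x) :=
  closure_subset_iff_isClosed.1 <|
    isPreconnected_connectedComponentIn.closure.subset_connectedComponentIn
      (subset_closure (mem_connectedComponentIn hx))
      (closure_minimal (connectedComponentIn_subset F x) hF)

/-- The graph on `κ` joining two distinct indices `a`, `b` when some `C i` meets both `W a`
and `W b`. -/
def commonMeetingGraph {X ι κ : Type*} (C : ι → Set X) (W : κ → Set X) : SimpleGraph κ where
  Adj a b := a ≠ b ∧ ∃ i, (C i ∩ W a).Nonempty ∧ (C i ∩ W b).Nonempty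
  symm := ⟨fun _ _ ⟨hne, i, ha, hb⟩ => ⟨hne.symm, i, hb, ha⟩⟩
  loopless := ⟨fun _ h => h.1 rfl⟩

theorem commonMeetingGraph_reachable {X ι κ : Type*} {C : ι → Set X} {W : κ → Set X} {a b : κ}
    {i : ι} (ha : (C i ∩ W a).Nonempty) (hb : (C i ∩ W b).Nonempty) :
    (commonMeetingGraph C W).Reachable a b := by
  by_cases hab : a = b
  · rw [hab]
  · exact SimpleGraph.Adj.reachable ⟨hab, i, ha, hb⟩

/-- If a connected space is a finite union of closed sets `C i` whose pairwise intersections are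
covered by the nonempty sets `W j`, then the graph of common meetings is connected. -/
theorem commonMeetingGraph_preconnected {X ι κ : Type*} [TopologicalSpace X] [PreconnectedSpace X]
    [Finite ι] {C : ι → Set X} {W : κ → Set X} (hCclosed : ∀ i, IsClosed (C i))
    (hCcover : ⋃ i, C i = univ) (hW : ∀ j, (W j).Nonempty)
    (hCW : ∀ i s, i ≠ s → C i ∩ C s ⊆ ⋃ j, W j) : (commonMeetingGraph C W).Preconnected := by
  intro a b
  have hmeet : ∀ j, ∃ i, (C i ∩ W j).Nonempty := fun j => by
    obtain ⟨x, hx⟩ := hW j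
    obtain ⟨i, hi⟩ := mem_iUnion.1 (hCcover.symm ▸ mem_univ x)
    exact ⟨i, x, hi, hx⟩
  let I : Set ι := {i | ∃ j, (commonMeetingGraph C W).Reachable a j ∧ (C i ∩ W j).Nonempty}
  have hdisj : ¬ (univ ∩ ((⋃ i ∈ I, C i) ∩ ⋃ i ∈ Iᶜ, C i)).Nonempty := by
    rintro ⟨x, -, hx, hx'⟩
    obtain ⟨i, hi, hxi⟩ := mem_iUnion₂.1 hx
    obtain ⟨s, hs, hxs⟩ := mem_iUnion₂.1 hx'
    obtain ⟨t, ht⟩ := mem_iUnion.1 (hCW i s (fun h => hs (h ▸ hi)) ⟨hxi, hxs⟩)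
    obtain ⟨j, haj, hj⟩ := hi
    exact hs ⟨t, haj.trans (commonMeetingGraph_reachable hj ⟨x, hxi, ht⟩), x, hxs, ht⟩
  obtain ⟨i, x, hxi, hxa⟩ := hmeet a
  obtain ⟨s, y, hys, hyb⟩ := hmeet b
  by_cases hs : s ∈ I
  · obtain ⟨j, haj, hj⟩ := hs
    exact haj.trans (commonMeetingGraph_reachable hj ⟨y, hys, hyb⟩)
  refine (hdisj (isPreconnected_closed_iff.1 isPreconnected_univ _ _
    (I.toFinite.isClosed_biUnion fun i _ => hCclosed i)
    (Iᶜ.toFinite.isClosed_biUnion fun i _ => hCclosed i) ?_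
    ⟨x, mem_univ x, mem_biUnion (show i ∈ I from ⟨a, .rfl, x, hxi, hxa⟩) hxi⟩
    ⟨y, mem_univ y, mem_biUnion (show s ∈ Iᶜ from hs) hys⟩)).elim
  intro z _
  obtain ⟨r, hr⟩ := mem_iUnion.1 (hCcover.symm ▸ mem_univ z)
  by_cases hrI : r ∈ I
  · exact Or.inl (mem_biUnion hrI hr)
  · exact Or.inr (mem_biUnion (show r ∈ Iᶜ from hrI) hr)

theorem isConnected_biUnion_diff {X ι : Type*} [TopologicalSpace X] {C : ι → Set X} {W V : Set X}
    (hC : ∀ i, IsPreirreducible (C i)) (hCcover : ⋃ i, C i = univ) (hW : IsConnected W)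
    (hV : IsClosed V) (hWV : Disjoint W V) :
    IsConnected ((⋃ i ∈ {i | (C i ∩ W).Nonempty}, C i) \ V) := by
  have hsub : W ⊆ (⋃ i ∈ {i | (C i ∩ W).Nonempty}, C i) \ V := fun y hy => by
    obtain ⟨i, hi⟩ := mem_iUnion.1 (hCcover.symm ▸ mem_univ y)
    exact ⟨mem_biUnion (show i ∈ {i | (C i ∩ W).Nonempty} from ⟨y, hi, hy⟩) hi,
      disjoint_left.1 hWV hy⟩
  obtain ⟨x, hx⟩ := hW.nonempty
  refine ⟨⟨x, hsub hx⟩, isPreconnected_of_forall x ?_⟩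
  rintro y ⟨hy, hyV⟩
  obtain ⟨i, hi, hyi⟩ := mem_iUnion₂.1 hy
  refine ⟨W ∪ C i ∩ Vᶜ, union_subset hsub fun z hz => ⟨mem_biUnion hi hz.1, hz.2⟩,
    Or.inl hx, Or.inr ⟨hyi, hyV⟩, ?_⟩
  obtain ⟨z, hzi, hzW⟩ := hi
  exact IsPreconnected.union z hzW ⟨hzi, disjoint_left.1 hWV hzW⟩ hW.isPreconnected
    ((hC i).inter_isOpen hV.isOpen_compl).isPreconnected

/-- Lemma 2.7(4): if `m ≥ 2` there is an index `k` with `⋃_{t ≠ k} T t` connected. -/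
theorem proetale_stmt11
    {X : Type*} [TopologicalSpace X] [Nonempty X]
    [TopologicalSpace.NoetherianSpace X] [ConnectedSpace X]
    {n m : ℕ}
    (C : Fin n → Set X) (hCinj : Function.Injective C)
    (hCrange : Set.range C = irreducibleComponents X)
    (Z : Set X) (hZclosed : IsClosed Z)
    (hZsing : ∀ i s : Fin n, i ≠ s → C i ∩ C s ⊆ Z)
    (hZnotcomp : ∀ i, ¬ C i ⊆ Z)
    (W : Fin m → Set X)
    (hWinj : Function.Injective W)
    (hWcc : ∀ j, ∃ x ∈ Z, W j = connectedComponentIn Z x)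
    (hWall : (⋃ j, W j) = Z)
    (T : Fin m → Set X)
    (hT : ∀ j, T j = (⋃ i ∈ {i : Fin n | (C i ∩ W j).Nonempty}, C i) \
      (⋃ t ∈ {t : Fin m | t ≠ j}, W t))
    (hm : 2 ≤ m) :
    ∃ k : Fin m, IsConnected (⋃ t ∈ {t : Fin m | t ≠ k}, T t) := by
  have hCmem : ∀ i, C i ∈ irreducibleComponents X := fun i => hCrange ▸ mem_range_self i
  have hCcover : ⋃ i, C i = univ := by
    rw [← sUnion_range, hCrange, sUnion_irreducibleComponents]
  have hWconn : ∀ j, IsConnected (W j) := fun j => by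
    obtain ⟨x, hx, h⟩ := hWcc j
    exact h ▸ isConnected_connectedComponentIn_iff.2 hx
  have hWclosed : ∀ j, IsClosed (W j) := fun j => by
    obtain ⟨x, hx, h⟩ := hWcc j
    exact h ▸ hZclosed.isClosed_connectedComponentIn hx
  have hWdisj : ∀ j t, t ≠ j → Disjoint (W j) (W t) := fun j t htj =>
    disjoint_left.2 fun y hyj hyt => htj <| hWinj <| by
      obtain ⟨x, -, h⟩ := hWcc j
      obtain ⟨x', -, h'⟩ := hWcc t
      rw [h] at hyj ⊢
      rw [h'] at hyt ⊢
      rw [connectedComponentIn_eq hyj, connectedComponentIn_eq hyt]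
  have hTconn : ∀ j, IsConnected (T j) := fun j => hT j ▸
    isConnected_biUnion_diff (fun i => (hCmem i).1.2) hCcover (hWconn j)
      ((toFinite _).isClosed_biUnion fun t _ => hWclosed t)
      (disjoint_iUnion₂_right.2 fun t ht => hWdisj j t ht)
  have hdiff : ∀ i j, (C i ∩ W j).Nonempty → C i \ Z ⊆ T j := fun i j hij y hy => by
    rw [hT j]
    refine ⟨mem_biUnion (show i ∈ {i | (C i ∩ W j).Nonempty} from hij) hy.1, fun h => hy.2 ?_⟩
    obtain ⟨t, -, ht⟩ := mem_iUnion₂.1 h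
    exact hWall ▸ mem_iUnion_of_mem t ht
  have : Nontrivial (Fin m) := Fin.nontrivial_iff_two_le.2 hm
  have hG : (commonMeetingGraph C W).Connected :=
    { preconnected := commonMeetingGraph_preconnected
        (fun i => isClosed_of_mem_irreducibleComponents _ (hCmem i)) hCcover
        (fun j => (hWconn j).nonempty) (hWall.symm ▸ hZsing)
      nonempty := inferInstance }
  obtain ⟨k, hk⟩ := hG.exists_connected_induce_compl_singleton_of_finite_nontrivial
  refine ⟨k, ?_⟩
  have := hk.nonempty
  have hunion : IsConnected (⋃ t : ({k}ᶜ : Set (Fin m)), T t) :=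
    IsConnected.iUnion_of_reflTransGen (fun t => hTconn t) fun a b =>
      Relation.ReflTransGen.mono (fun a b ⟨_, i, ha, hb⟩ => by
          obtain ⟨y, hy⟩ := not_subset.1 (hZnotcomp i)
          exact ⟨y, hdiff i a ha hy, hdiff i b hb hy⟩) _ _
        ((SimpleGraph.reachable_iff_reflTransGen a b).1 (hk.preconnected a b))
  rwa [iUnion_subtype] at hunion
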